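/- Let α, ε, μ, p be real numbers with α ≠ 0, μ ≠ 0, p ≠ 0, let κ, λ ∈ ℂ satisfy κ² = (2μ/α)(ε+i), λ² = (2μ/α)(ε−i), set z₀ = μp/α, define f(z) = αz²/(2μ) − ε, A(z) = p·f(z)/(1+f(z)²), B(z) = p/μ − (αz+(2−μ)p)/(1+f(z)²), C(z) = (αz−μp)/(1+f(z)²), r(z) = (C'/C)·A + A² + C·B − A' − (1/2)(C'/C)' + (1/4)(C'/C)², and Θ(z) = −1/(z−z₀) + 1/(z−κ) + 1/(z+κ) + 1/(z−λ) + 1/(z+λ). Then Ξ := Θ'' + 3ΘΘ' + Θ³ − 4rΘ − 2r' is not identically zero: Ξ(z) = p·P_*(z)/((z−z₀)²(z−κ)²(z+κ)²(z−λ)²(z+λ)²) for a polynomial P_* with leading term 3i(κ²−λ²)z⁶ ≠ 0; in particular there exists z ∈ ℂ, distinct from z₀, ±κ, ±λ, with Ξ(z) ≠ 0. -/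

import Mathlib

open Complex

section helpers
open Polynomial

lemma aux_hd {u v : ℂ → ℂ} {d d' z : ℂ} (h : HasDerivAt v d' z) (h1 : ∀ x, u x = v x) (h2 : d = d') :
    HasDerivAt u d z := by
  rw [funext h1, h2]
  exact h

lemma aux_poly (a e m p w0 : ℂ) (ha : a ≠ 0) : ∃ P : Polynomial ℂ, P.natDegree = 6 ∧ P.coeff 6 = -6 / a ∧
    ∀ z f D w : ℂ, f = a * z ^ 2 - e → D = 1 + f ^ 2 → w = z - w0 →
      P.eval z = (6*f*D - (2*a*z)*(6+10*f^2)*w + (4*f*(2*a*z)^2 + 4*a*D)*w^2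
        + 4*p*(f^2*w - f*(2*a*z)*w^2) + (4*a*D - 8*a*w*f*(2*a*z) - 8*a*m)*w^2) / a^4 := by
  have key : ∃ c5 c4 c3 c2 c1 c0 : ℂ, ∀ z f D w : ℂ, f = a * z ^ 2 - e → D = 1 + f ^ 2 → w = z - w0 →
      (6*f*D - (2*a*z)*(6+10*f^2)*w + (4*f*(2*a*z)^2 + 4*a*D)*w^2
        + 4*p*(f^2*w - f*(2*a*z)*w^2) + (4*a*D - 8*a*w*f*(2*a*z) - 8*a*m)*w^2) =
      (-6*a^3) * z^6 + c5 * z^5 + c4*z^4+c3*z^3+c2*z^2+c1*z+c0 := by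
    refine ⟨(20)*a^3*w0^1+(-4)*a^2*p^1, (6)*a^2*e^1+(-24)*a^3*w0^2+(12)*a^2*p^1*w0^1, (-24)*a^2*e^1*w0^1+(-8)*a^2*p^1*w0^2+(16)*a^3*w0^3, (6)*a^1*e^2+(2)*a^1+(16)*a^2*e^1*w0^2+(-8)*a^1*e^1*p^1*w0^1+(-8)*a^1*m^1, (4)*a^1*e^2*w0^1+(-4)*a^1*w0^1+(4)*e^2*p^1+(8)*a^1*e^1*p^1*w0^2+(-16)*a^2*e^1*w0^3+(16)*a^1*m^1*w0^1, (-6)*e^3+(-6)*e^1+(8)*a^1*e^2*w0^2+(8)*a^1*w0^2+(-4)*e^2*p^1*w0^1+(-8)*a^1*m^1*w0^2, ?_⟩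
    rintro z f D w rfl rfl rfl
    ring
  obtain ⟨c5, c4, c3, c2, c1, c0, h⟩ := key
  have hc : (C (-6/a) * X^6 + C (c5/a^4) * X^5 + C (c4/a^4) * X^4 + C (c3/a^4) * X^3 + C (c2/a^4) * X^2
    + C (c1/a^4) * X + C (c0/a^4) : ℂ[X]).coeff 6 = -6/a := by
    simp [coeff_X, coeff_C, coeff_X_pow]
  refine ⟨C (-6/a) * X^6 + C (c5/a^4) * X^5 + C (c4/a^4) * X^4 + C (c3/a^4) * X^3 + C (c2/a^4) * X^2
    + C (c1/a^4) * X + C (c0/a^4), ?_, hc, ?_⟩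
  · apply le_antisymm
    · compute_degree
    · apply le_natDegree_of_ne_zero
      rw [hc]
      simp [ha]
  · intro z f D w h1 h2 h3
    rw [h z f D w h1 h2 h3]
    simp only [eval_add, eval_mul, eval_C, eval_pow, eval_X]
    field_simp

lemma aux_alg (a m p z f D w : ℂ) (hm : m ≠ 0) (hD : D ≠ 0) (hw : w ≠ 0)
    (hDf : D = 1 + f^2)
    (A A1 A2 B B1 K K1 G G1 G2 : ℂ)
    (hA : A = p * f / D) (hA1 : A1 = p * ((2*a*z) * (1 - f^2)) / D^2)
    (hA2 : A2 = p * ((2*a*(1-f^2) - 2*f*(2*a*z)^2) / D^2 - 4*f*(2*a*z)^2*(1-f^2)/D^3))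
    (hK : K = 2*m*a*w/D) (hK1 : K1 = G * K)
    (hB : B = p/m - K - 2*p/D) (hB1 : B1 = - K1 + 4*p*f*(2*a*z)/D^2)
    (hG : G = 1/w - 2*f*(2*a*z)/D)
    (hG1 : G1 = -1/w^2 - (2*(2*a*z)^2 + 4*a*f)/D + 4*f^2*(2*a*z)^2/D^2) :
    -G2 + 3 * (-G) * (-G1) + (-G)^3 - 4 * (G*A + A^2 + K*B - A1 - (1/2)*G1 + (1/4)*G^2) * (-G)
     - 2 * (G1*A + G*A1 + 2*A*A1 + (K1*B + K*B1) - A2 - (1/2)*G2 + (1/2)*G*G1) =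
    p * (6*f*D - (2*a*z)*(6+10*f^2)*w + (4*f*(2*a*z)^2 + 4*a*D)*w^2
        + 4*p*(f^2*w - f*(2*a*z)*w^2) + (4*a*D - 8*a*w*f*(2*a*z) - 8*a*m)*w^2) / (w^2 * D^2) := by
  have e1 : K*(G*B - B1) = p * (4*a*D - 8*a*w*f*(2*a*z) - 8*a*m) / (2 * D^2) := by
    rw [hB1, hK1, hB, hG, hK]
    field_simp
    ring
  have e2 : 4*G*A^2 - 4*A*A1 = p * (4*p*(f^2*w - f*(2*a*z)*w^2)) / (w^2 * D^2) := by
    rw [hA, hA1, hG]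
    field_simp
    rw [hDf]
    ring
  have e3 : 4*G^2*A - 6*G*A1 - 2*G1*A + 2*A2 = p * (6*f*D - (2*a*z)*(6+10*f^2)*w + (4*f*(2*a*z)^2 + 4*a*D)*w^2) / (w^2 * D^2) := by
    rw [hA, hA1, hA2, hG, hG1]
    field_simp
    rw [hDf]
    ring
  have e4 : p * (6*f*D - (2*a*z)*(6+10*f^2)*w + (4*f*(2*a*z)^2 + 4*a*D)*w^2
        + 4*p*(f^2*w - f*(2*a*z)*w^2) + (4*a*D - 8*a*w*f*(2*a*z) - 8*a*m)*w^2) / (w^2 * D^2)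
      = p * (6*f*D - (2*a*z)*(6+10*f^2)*w + (4*f*(2*a*z)^2 + 4*a*D)*w^2) / (w^2 * D^2)
       + p * (4*p*(f^2*w - f*(2*a*z)*w^2)) / (w^2 * D^2) + 2 * (p * (4*a*D - 8*a*w*f*(2*a*z) - 8*a*m) / (2 * D^2)) := by
    field_simp
  rw [e4, ← e1, ← e2, ← e3, hK1]
  ring

end helpers

/-- The Kovacic case II candidate `Θ` fails: `Ξ = Θ'' + 3ΘΘ' + Θ³ − 4rΘ − 2r'`
is not identically zero (sphere, Newton potential). -/
theorem stmt_10 (α ε μ p : ℝ) (hα : α ≠ 0) (hμ : μ ≠ 0) (hp : p ≠ 0)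
    (κ lam : ℂ)
    (hκ : κ ^ 2 = (2 * (μ : ℂ) / (α : ℂ)) * ((ε : ℂ) + I))
    (hlam : lam ^ 2 = (2 * (μ : ℂ) / (α : ℂ)) * ((ε : ℂ) - I))
    (z₀ : ℂ) (hz₀ : z₀ = (μ : ℂ) * (p : ℂ) / (α : ℂ))
    (f A B C g r Θ Ξ : ℂ → ℂ)
    (hf : ∀ z, f z = (α : ℂ) * z ^ 2 / (2 * (μ : ℂ)) - (ε : ℂ))
    (hA : ∀ z, A z = (p : ℂ) * f z / (1 + (f z) ^ 2))
    (hB : ∀ z, B z = (p : ℂ) / (μ : ℂ) - ((α : ℂ) * z + (2 - (μ : ℂ)) * (p : ℂ)) / (1 + (f z) ^ 2))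
    (hC : ∀ z, C z = ((α : ℂ) * z - (μ : ℂ) * (p : ℂ)) / (1 + (f z) ^ 2))
    (hg : ∀ z, g z = deriv C z / C z)
    (hr : ∀ z, r z = g z * A z + (A z) ^ 2 + C z * B z - deriv A z
      - (1/2) * deriv g z + (1/4) * (g z) ^ 2)
    (hΘ : ∀ z, Θ z = -1 / (z - z₀) + 1 / (z - κ) + 1 / (z + κ) + 1 / (z - lam) + 1 / (z + lam))
    (hΞ : ∀ z, Ξ z = deriv (deriv Θ) z + 3 * Θ z * deriv Θ z + (Θ z) ^ 3
      - 4 * r z * Θ z - 2 * deriv r z) :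
    (∃ P : Polynomial ℂ, P.natDegree = 6 ∧ P.coeff 6 = 3 * I * (κ ^ 2 - lam ^ 2) ∧
      3 * I * (κ ^ 2 - lam ^ 2) ≠ 0 ∧
      ∀ z : ℂ, z ≠ z₀ → z ≠ κ → z ≠ -κ → z ≠ lam → z ≠ -lam →
        Ξ z = (p : ℂ) * P.eval z /
          ((z - z₀) ^ 2 * (z - κ) ^ 2 * (z + κ) ^ 2 * (z - lam) ^ 2 * (z + lam) ^ 2)) ∧
    ∃ z : ℂ, z ≠ z₀ ∧ z ≠ κ ∧ z ≠ -κ ∧ z ≠ lam ∧ z ≠ -lam ∧ Ξ z ≠ 0 := by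
  have ha' : (α : ℂ) ≠ 0 := by exact_mod_cast hα
  have hm' : (μ : ℂ) ≠ 0 := by exact_mod_cast hμ
  have hp' : (p : ℂ) ≠ 0 := by exact_mod_cast hp
  obtain ⟨a, ha_def⟩ : ∃ a : ℂ, a = (α : ℂ) / (2 * (μ : ℂ)) := ⟨_, rfl⟩
  have ha : a ≠ 0 := by rw [ha_def]; exact div_ne_zero ha' (mul_ne_zero two_ne_zero hm')
  have hαa : (α : ℂ) = 2 * μ * a := by rw [ha_def]; field_simp
  generalize (α : ℂ) = α' at *
  generalize (μ : ℂ) = m at *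
  generalize (p : ℂ) = q at *
  generalize (ε : ℂ) = e at *
  subst hαa
  have hκ' : κ ^ 2 = (e + I) / a := by rw [hκ]; field_simp
  have hlam' : lam ^ 2 = (e - I) / a := by rw [hlam]; field_simp
  have hz : q = 2 * a * z₀ := by rw [hz₀]; field_simp
  have hf' : ∀ z, f z = a * z ^ 2 - e := by intro z; rw [hf]; field_simp
  have hlead : 3 * I * (κ ^ 2 - lam ^ 2) = -6 / a := by
    rw [hκ', hlam']; field_simp; ring_nf; simp
  have hlead0 : (-6 : ℂ) / a ≠ 0 := by simp [ha]
  have hDfac : ∀ z, 1 + (f z) ^ 2 = a ^ 2 * ((z - κ) * (z + κ) * ((z - lam) * (z + lam))) := by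
    intro z
    have h1 : (z - κ) * (z + κ) = z ^ 2 - (e + I) / a := by rw [← hκ']; ring
    have h2 : (z - lam) * (z + lam) = z ^ 2 - (e - I) / a := by rw [← hlam']; ring
    rw [h1, h2, hf']
    field_simp
    ring_nf
    simp
    try ring
  have hC' : ∀ z, C z = 2 * m * a * (z - z₀) / (1 + f z ^ 2) := by
    intro z; rw [hC, hz]; ring
  have hB' : ∀ z, B z = q / m - C z - 2 * q / (1 + f z ^ 2) := by
    intro z; rw [hB, hC]; ring
  have hfd : ∀ z, HasDerivAt f (2 * a * z) z := by
    intro z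
    have : f = fun z => a * z ^ 2 - e := funext hf'
    rw [this]
    refine aux_hd (((hasDerivAt_pow 2 z).const_mul a).sub_const e) (fun x => by first | rfl | (simp <;> done) | (simp; ring)) ?_
    try simp only [Pi.mul_apply, Pi.pow_apply, Pi.add_apply, Pi.sub_apply]
    push_cast; ring
  have hDd : ∀ z, HasDerivAt (fun z => 1 + f z ^ 2) (2 * f z * (2 * a * z)) z := by
    intro z
    refine aux_hd (((hfd z).pow 2).const_add 1) (fun x => by first | rfl | (simp <;> done) | (simp; ring)) ?_
    try simp only [Pi.mul_apply, Pi.pow_apply, Pi.add_apply, Pi.sub_apply]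
    push_cast; ring
  have hwd : ∀ z, HasDerivAt (fun z => z - z₀) 1 z := fun z => (hasDerivAt_id z).sub_const z₀
  have hzd : ∀ z, HasDerivAt (fun z : ℂ => 2 * a * z) (2 * a) z := by
    intro z
    simpa using (hasDerivAt_id z).const_mul (2 * a)
  obtain ⟨G, hG⟩ : ∃ G : ℂ → ℂ, ∀ z, G z = 1 / (z - z₀) - 2 * f z * (2 * a * z) / (1 + f z ^ 2) := ⟨_, fun _ => rfl⟩
  obtain ⟨G1, hG1⟩ : ∃ G1 : ℂ → ℂ, ∀ z, G1 z = -1/(z - z₀)^2 - (2*(2*a*z)^2 + 4*a*f z)/(1 + f z ^ 2) + 4*(f z)^2*(2*a*z)^2/(1 + f z ^ 2)^2 := ⟨_, fun _ => rfl⟩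
  obtain ⟨A1, hA1⟩ : ∃ A1 : ℂ → ℂ, ∀ z, A1 z = q * ((2*a*z) * (1 - (f z)^2)) / (1 + f z ^ 2)^2 := ⟨_, fun _ => rfl⟩
  obtain ⟨U, hU⟩ : ∃ U : Set ℂ, U = {z | z - z₀ ≠ 0 ∧ 1 + f z ^ 2 ≠ 0} := ⟨_, rfl⟩
  have hfc : Continuous f := by
    rw [show f = fun z => a * z ^ 2 - e from funext hf']; fun_prop
  have hUo : IsOpen U := by
    rw [hU]
    exact (isOpen_ne_fun (by fun_prop) (by fun_prop)).inter (isOpen_ne_fun (by fun_prop) (by fun_prop))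
  have hCd : ∀ z ∈ U, HasDerivAt C (G z * C z) z := by
    intro z hzU
    rw [hU] at hzU
    obtain ⟨h1, h2⟩ := hzU
    rw [show C = fun z => 2 * m * a * (z - z₀) / (1 + f z ^ 2) from funext hC']
    refine aux_hd (((hwd z).const_mul (2 * m * a)).div (hDd z) h2) (fun x => by first | rfl | (simp <;> done) | (simp; ring)) ?_
    try simp only [Pi.mul_apply, Pi.pow_apply, Pi.add_apply, Pi.sub_apply]
    rw [hG]
    field_simp
  have hC0 : ∀ z ∈ U, C z ≠ 0 := by
    intro z hzU
    rw [hU] at hzU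
    obtain ⟨h1, h2⟩ := hzU
    rw [hC']
    exact div_ne_zero (mul_ne_zero (mul_ne_zero (mul_ne_zero two_ne_zero hm') ha) h1) h2
  have hgG : ∀ z ∈ U, g z = G z := by
    intro z hzU
    rw [hg, (hCd z hzU).deriv]
    exact mul_div_cancel_right₀ _ (hC0 z hzU)
  have hΘG : ∀ z ∈ U, Θ z = - G z := by
    intro z hzU
    rw [hU] at hzU
    obtain ⟨h1, h2⟩ := hzU
    have h3 := h2
    rw [hDfac] at h3
    have k1 : z - κ ≠ 0 := by rintro h; simp [h] at h3
    have k2 : z + κ ≠ 0 := by rintro h; simp [h] at h3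
    have k3 : z - lam ≠ 0 := by rintro h; simp [h] at h3
    have k4 : z + lam ≠ 0 := by rintro h; simp [h] at h3
    have k5 : 2 * f z = a * ((z - κ) * (z + κ)) + a * ((z - lam) * (z + lam)) := by
      have h1 : (z - κ) * (z + κ) = z ^ 2 - (e + I) / a := by rw [← hκ']; ring
      have h2 : (z - lam) * (z + lam) = z ^ 2 - (e - I) / a := by rw [← hlam']; ring
      rw [h1, h2, hf']
      field_simp
      ring
    rw [hΘ, hG, hDfac, k5]
    field_simp
    ring
  have hGd : ∀ z ∈ U, HasDerivAt G (G1 z) z := by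
    intro z hzU
    rw [hU] at hzU
    obtain ⟨h1, h2⟩ := hzU
    rw [show G = _ from funext hG]
    refine aux_hd (((hasDerivAt_const z (1:ℂ)).div (hwd z) h1).sub ((((hfd z).const_mul 2).mul (hzd z)).div (hDd z) h2)) (fun x => by first | rfl | (simp <;> done) | (simp; ring)) ?_
    try simp only [Pi.mul_apply, Pi.pow_apply, Pi.add_apply, Pi.sub_apply]
    rw [hG1]
    field_simp
    ring
  have hAd : ∀ z ∈ U, HasDerivAt A (A1 z) z := by
    intro z hzU
    rw [hU] at hzU
    obtain ⟨h1, h2⟩ := hzU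
    rw [show A = _ from funext hA]
    refine aux_hd (((hfd z).const_mul q).div (hDd z) h2) (fun x => by first | rfl | (simp <;> done) | (simp; ring)) ?_
    try simp only [Pi.mul_apply, Pi.pow_apply, Pi.add_apply, Pi.sub_apply]
    rw [hA1]
    field_simp
    ring
  have hA1d : ∀ z ∈ U, HasDerivAt A1 (q * ((2*a*(1-(f z)^2) - 2*f z*(2*a*z)^2) / (1 + f z ^ 2)^2 - 4*f z*(2*a*z)^2*(1-(f z)^2)/(1 + f z ^ 2)^3)) z := by
    intro z hzU
    rw [hU] at hzU
    obtain ⟨h1, h2⟩ := hzU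
    rw [show A1 = _ from funext hA1]
    refine aux_hd (((((hzd z).mul (((hfd z).pow 2).const_sub 1)).const_mul q).div ((hDd z).pow 2) (pow_ne_zero 2 h2))) (fun x => by first | rfl | (simp <;> done) | (simp; ring)) ?_
    try simp only [Pi.mul_apply, Pi.pow_apply, Pi.add_apply, Pi.sub_apply]
    push_cast
    field_simp
    ring
  have hBd : ∀ z ∈ U, HasDerivAt B (-(G z * C z) + 4*q*f z*(2*a*z)/(1 + f z ^ 2)^2) z := by
    intro z hzU
    have hc := hCd z hzU
    rw [hU] at hzU
    obtain ⟨h1, h2⟩ := hzU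
    rw [show B = _ from funext hB']
    refine aux_hd ((hc.const_sub (q / m)).sub ((hasDerivAt_const z (2 * q)).div (hDd z) h2)) (fun x => by first | rfl | (simp <;> done) | (simp; ring)) ?_
    try simp only [Pi.mul_apply, Pi.pow_apply, Pi.add_apply, Pi.sub_apply]
    field_simp
    ring
  have hG1d : ∀ z ∈ U, ∃ G2, HasDerivAt G1 G2 z := by
    intro z hzU
    rw [hU] at hzU
    obtain ⟨h1, h2⟩ := hzU
    have hfz := (hfd z).differentiableAt
    have hsq : (z - z₀) ^ 2 ≠ 0 := pow_ne_zero 2 h1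
    have hsq2 : (1 + f z ^ 2) ^ 2 ≠ 0 := pow_ne_zero 2 h2
    refine ⟨_, DifferentiableAt.hasDerivAt ?_⟩
    rw [show G1 = _ from funext hG1]
    fun_prop (disch := assumption)
  have hrR : ∀ z ∈ U, r z = G z * A z + A z ^ 2 + C z * B z - A1 z - (1/2) * G1 z + (1/4) * G z ^ 2 := by
    intro z hzU
    have : g =ᶠ[nhds z] G := Filter.eventually_of_mem (hUo.mem_nhds hzU) hgG
    rw [hr, this.deriv_eq, (hGd z hzU).deriv, (hAd z hzU).deriv, hgG z hzU]
  have hΘd : ∀ z ∈ U, deriv Θ z = - G1 z := by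
    intro z hzU
    have : Θ =ᶠ[nhds z] fun z => - G z := Filter.eventually_of_mem (hUo.mem_nhds hzU) hΘG
    rw [this.deriv_eq]
    exact (hGd z hzU).neg.deriv
  obtain ⟨P, hP1, hP2, hP3⟩ := aux_poly a e m q z₀ ha
  have hmemU : ∀ z, z ≠ z₀ → z ≠ κ → z ≠ -κ → z ≠ lam → z ≠ -lam → z ∈ U := by
    intro z h1 h2 h3 h4 h5
    rw [hU]
    refine ⟨sub_ne_zero.2 h1, ?_⟩
    rw [hDfac]
    exact mul_ne_zero (pow_ne_zero 2 ha) (mul_ne_zero (mul_ne_zero (sub_ne_zero.2 h2) (fun h => h3 (eq_neg_of_add_eq_zero_left h)))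
      (mul_ne_zero (sub_ne_zero.2 h4) (fun h => h5 (eq_neg_of_add_eq_zero_left h))))
  have main : ∀ z : ℂ, z ≠ z₀ → z ≠ κ → z ≠ -κ → z ≠ lam → z ≠ -lam →
        Ξ z = q * P.eval z /
          ((z - z₀) ^ 2 * (z - κ) ^ 2 * (z + κ) ^ 2 * (z - lam) ^ 2 * (z + lam) ^ 2) := by
    intro z h1 h2 h3 h4 h5
    have hzU := hmemU z h1 h2 h3 h4 h5
    obtain ⟨G2, hG2⟩ := hG1d z hzU
    have hrd : HasDerivAt r (G1 z * A z + G z * A1 z + 2 * A z * A1 z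
        + (G z * C z * B z + C z * (-(G z * C z) + 4*q*f z*(2*a*z)/(1 + f z ^ 2)^2))
        - (q * ((2*a*(1-(f z)^2) - 2*f z*(2*a*z)^2) / (1 + f z ^ 2)^2 - 4*f z*(2*a*z)^2*(1-(f z)^2)/(1 + f z ^ 2)^3))
        - (1/2) * G2 + (1/2) * G z * G1 z) z := by
      have : r =ᶠ[nhds z] fun z => G z * A z + A z ^ 2 + C z * B z - A1 z - (1/2) * G1 z + (1/4) * G z ^ 2 :=
        Filter.eventually_of_mem (hUo.mem_nhds hzU) hrR
      refine HasDerivAt.congr_of_eventuallyEq ?_ this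
      refine aux_hd (((((((hGd z hzU).mul (hAd z hzU)).add ((hAd z hzU).pow 2)).add ((hCd z hzU).mul (hBd z hzU))).sub
        (hA1d z hzU)).sub (hG2.const_mul (1/2))).add (((hGd z hzU).pow 2).const_mul (1/4))) (fun x => by first | rfl | (simp <;> done) | (simp; ring)) ?_
      try simp only [Pi.mul_apply, Pi.pow_apply, Pi.add_apply, Pi.sub_apply]
      push_cast
      ring
    have hΘ2 : deriv (deriv Θ) z = - G2 := by
      have : deriv Θ =ᶠ[nhds z] fun z => - G1 z := Filter.eventually_of_mem (hUo.mem_nhds hzU) hΘd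
      rw [this.deriv_eq]
      exact hG2.neg.deriv
    rw [hΞ, hΘ2, hΘd z hzU, hΘG z hzU, hrR z hzU, hrd.deriv]
    have hzU' := hzU
    rw [hU] at hzU'
    obtain ⟨u1, u2⟩ := hzU'
    rw [aux_alg a m q z (f z) (1 + f z ^ 2) (z - z₀) hm' u2 u1 rfl (A z) (A1 z) _ (B z) _ (C z) _ (G z) (G1 z) G2
      (hA z) (hA1 z) rfl (hC' z) rfl (hB' z) rfl (hG z) (hG1 z)]
    rw [hP3 z (f z) (1 + f z ^ 2) (z - z₀) (hf' z) rfl rfl]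
    generalize (6 * f z * (1 + f z ^ 2) - _ + _ + _ + _ : ℂ) = N
    rw [hDfac]
    have e1 : (z - z₀) ^ 2 * (a ^ 2 * ((z - κ) * (z + κ) * ((z - lam) * (z + lam)))) ^ 2
      = a ^ 4 * ((z - z₀) ^ 2 * (z - κ) ^ 2 * (z + κ) ^ 2 * (z - lam) ^ 2 * (z + lam) ^ 2) := by ring
    rw [e1, ← div_div, mul_div_assoc]
  refine ⟨⟨P, hP1, by rw [hP2, hlead], by rw [hlead]; exact hlead0, main⟩, ?_⟩
  by_contra hcon
  push Not at hcon
  have hP0 : P ≠ 0 := by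
    rintro rfl
    simp at hP1
  have hQ : P * ((Polynomial.X - Polynomial.C z₀) * (Polynomial.X - Polynomial.C κ) * (Polynomial.X - Polynomial.C (-κ)) * (Polynomial.X - Polynomial.C lam) * (Polynomial.X - Polynomial.C (-lam))) = 0 := by
    apply Polynomial.funext
    intro z
    simp only [Polynomial.eval_mul, Polynomial.eval_sub, Polynomial.eval_X, Polynomial.eval_C, Polynomial.eval_zero]
    by_contra hne
    simp only [mul_eq_zero, not_or, sub_eq_zero] at hne
    obtain ⟨n0, ⟨⟨⟨n1, n2⟩, n3⟩, n4⟩, n5⟩ := hne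
    have h0 := hcon z n1 n2 n3 n4 n5
    rw [main z n1 n2 n3 n4 n5] at h0
    have k3 : z + κ ≠ 0 := fun h => n3 (eq_neg_of_add_eq_zero_left h)
    have k5 : z + lam ≠ 0 := fun h => n5 (eq_neg_of_add_eq_zero_left h)
    refine div_ne_zero (mul_ne_zero hp' n0) ?_ h0
    have := sub_ne_zero.2 n1
    have := sub_ne_zero.2 n2
    have := sub_ne_zero.2 n4
    simp only [ne_eq, mul_eq_zero, pow_eq_zero_iff, OfNat.ofNat_ne_zero, not_false_eq_true, not_or]
    tauto
  refine mul_ne_zero hP0 ?_ hQ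
  simp only [ne_eq, mul_eq_zero, Polynomial.X_sub_C_ne_zero, or_self, not_false_eq_true]
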